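/- Let w be a weight on ℝ with finite dyadic A₂ constant Q := [w]_{A₂}, σ := 1/w, 0 < α < 1/2, and m, n ≥ 0 integers. For a dyadic interval L let 𝒫_L be the family of stopping intervals: dyadic K with K ⊆ L and |K| ≥ 2^{−m}|L| such that [Δ_K w/⟨w⟩_K ≥ 1/(m+n+1), or Δ_K σ/⟨σ⟩_K ≥ 1/(m+n+1), or |K| = 2^{−m}|L|] and every dyadic J with K ⊊ J ⊆ L satisfies Δ_J w/⟨w⟩_J < 1/(m+n+1) and Δ_J σ/⟨σ⟩_J < 1/(m+n+1). Define μ̃_L := ∑_{K ∈ 𝒫_L} μ_K. Then there is a constant c_α depending only on α such that the family {μ̃_L} is Carleson with constant c_α (m+1) Q^α: for every dyadic interval I, ∑_{L dyadic, L ⊆ I} μ̃_L ≤ c_α (m+1) Q^α |I|. -/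

import Mathlib

open MeasureTheory Set
open scoped ENNReal Classical

noncomputable section

/-- Length of a dyadic interval of generation `j`. -/
def dlen (j : ℤ) : ℝ := (2 : ℝ) ^ (-j)

/-- The dyadic interval `I_{j,k} = [k·2^{-j}, (k+1)·2^{-j})`. -/
def dyad (j k : ℤ) : Set ℝ := Set.Ico ((k : ℝ) * dlen j) (((k : ℝ) + 1) * dlen j)

/-- Average `⟨f⟩_I` of `f` over the dyadic interval `I = I_{j,k}`. -/
def avg (f : ℝ → ℝ) (j k : ℤ) : ℝ := (dlen j)⁻¹ * ∫ x in dyad j k, f x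

/-- The Haar function `h_I` of the dyadic interval `I = I_{j,k}`. -/
def haar (j k : ℤ) : ℝ → ℝ := fun x =>
  (Real.sqrt (dlen j))⁻¹ *
    ((dyad (j + 1) (2 * k + 1)).indicator (fun _ => (1 : ℝ)) x -
      (dyad (j + 1) (2 * k)).indicator (fun _ => (1 : ℝ)) x)

/-- `Δ_I w` for `I = I_{j,k}`. -/
def dOsc (w : ℝ → ℝ) (j k : ℤ) : ℝ :=
  |avg w (j + 1) (2 * k) - avg w j k| + |avg w (j + 1) (2 * k + 1) - avg w j k|

/-- `μ_K = (⟨w⟩_K⟨σ⟩_K)^α ((Δ_K w)²/⟨w⟩_K² + (Δ_K σ)²/⟨σ⟩_K²)|K|`, `σ = w⁻¹`. -/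
def muTerm (α : ℝ) (w : ℝ → ℝ) (j k : ℤ) : ℝ :=
  (avg w j k * avg (fun x => (w x)⁻¹) j k) ^ α *
    ((dOsc w j k) ^ 2 / (avg w j k) ^ 2 +
      (dOsc (fun x => (w x)⁻¹) j k) ^ 2 / (avg (fun x => (w x)⁻¹) j k) ^ 2) * dlen j

/-- `K = I_{jK,kK}` belongs to the stopping family `𝒫_L` of `L = I_{jL,kL}`. -/
def IsStopping (w : ℝ → ℝ) (m n : ℕ) (jL kL jK kK : ℤ) : Prop :=
  dyad jK kK ⊆ dyad jL kL ∧ jK ≤ jL + m ∧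
    ((1 : ℝ) / ((m : ℝ) + n + 1) ≤ dOsc w jK kK / avg w jK kK ∨
      (1 : ℝ) / ((m : ℝ) + n + 1) ≤
        dOsc (fun x => (w x)⁻¹) jK kK / avg (fun x => (w x)⁻¹) jK kK ∨
      jK = jL + m) ∧
    ∀ jJ kJ : ℤ, dyad jK kK ⊂ dyad jJ kJ → dyad jJ kJ ⊆ dyad jL kL →
      dOsc w jJ kJ / avg w jJ kJ < (1 : ℝ) / ((m : ℝ) + n + 1) ∧
      dOsc (fun x => (w x)⁻¹) jJ kJ / avg (fun x => (w x)⁻¹) jJ kJ <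
        (1 : ℝ) / ((m : ℝ) + n + 1)

/-- `μ̃_L = ∑_{K ∈ 𝒫_L} μ_K`. -/
def muTilde (α : ℝ) (w : ℝ → ℝ) (m n : ℕ) (jL kL : ℤ) : ℝ≥0∞ :=
  ∑' q : ℤ × ℤ,
    if IsStopping w m n jL kL q.1 q.2 then ENNReal.ofReal (muTerm α w q.1 q.2) else 0

lemma dlen_pos (j : ℤ) : 0 < dlen j := by unfold dlen; positivity

lemma dlen_succ (j : ℤ) : dlen (j + 1) = dlen j / 2 := by
  unfold dlen
  rw [neg_add, zpow_add₀ (by norm_num)]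
  norm_num
  ring

lemma dlen_add (j : ℤ) (i : ℕ) : dlen j = 2 ^ i * dlen (j + i) := by
  unfold dlen
  rw [neg_add, zpow_add₀ (by norm_num), zpow_neg, zpow_neg, zpow_natCast]
  field_simp

lemma dyad_subset_iff (j' k' j k : ℤ) : dyad j' k' ⊆ dyad j k ↔
    (k : ℝ) * dlen j ≤ k' * dlen j' ∧ ((k' : ℝ) + 1) * dlen j' ≤ (k + 1) * dlen j := by
  unfold dyad
  rw [Set.Ico_subset_Ico_iff]
  have := dlen_pos j'
  nlinarith

lemma dyad_subset_le {j' k' j k : ℤ} (h : dyad j' k' ⊆ dyad j k) : j ≤ j' := by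
  rw [dyad_subset_iff] at h
  have h1 : dlen j' ≤ dlen j := by nlinarith [h.1, h.2]
  unfold dlen at h1
  have := (zpow_le_zpow_iff_right₀ (by norm_num : (1:ℝ) < 2)).1 h1
  omega

lemma dyad_subset_cases {j' k' j k : ℤ} (h : dyad j' k' ⊆ dyad j k) :
    (j' = j ∧ k' = k) ∨ dyad j' k' ⊆ dyad (j + 1) (2 * k) ∨
      dyad j' k' ⊆ dyad (j + 1) (2 * k + 1) := by
  have hle := dyad_subset_le h
  obtain ⟨i, rfl⟩ := Int.le.dest hle
  rw [dyad_subset_iff] at h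
  have hp := dlen_pos (j + i)
  rw [dlen_add j i] at h
  obtain ⟨h1, h2⟩ := h
  have h1' : (k : ℝ) * 2 ^ i ≤ k' := by
    refine le_of_mul_le_mul_right ?_ hp
    linarith
  have h2' : (k' : ℝ) + 1 ≤ (k + 1) * 2 ^ i := by
    refine le_of_mul_le_mul_right ?_ hp
    linarith
  rcases i with _ | e
  · left
    norm_num at h1' h2'
    simp
    omega
  · right
    have hd : dlen (j + 1) = 2 ^ e * dlen (j + (e + 1 : ℕ)) := by
      rw [dlen_add (j + 1) e]
      congr 2
      push_cast
      ring
    rw [dyad_subset_iff, dyad_subset_iff, hd]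
    push_cast
    push_cast at hp
    rw [pow_succ] at h1' h2'
    rcases le_or_gt (k' + 1) ((2 * k + 1) * 2 ^ e) with hc | hc
    · left
      have hc' : (k' : ℝ) + 1 ≤ (2 * k + 1) * 2 ^ e := by exact_mod_cast hc
      constructor
      · rw [← mul_assoc]
        exact mul_le_mul_of_nonneg_right (by linarith) hp.le
      · rw [← mul_assoc]
        exact mul_le_mul_of_nonneg_right (by linarith) hp.le
    · right
      have hc' : (2 * (k : ℝ) + 1) * 2 ^ e ≤ k' := by
        have : (2 * k + 1) * 2 ^ e ≤ k' := by omega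
        exact_mod_cast this
      constructor
      · rw [← mul_assoc]
        exact mul_le_mul_of_nonneg_right (by linarith) hp.le
      · rw [← mul_assoc]
        exact mul_le_mul_of_nonneg_right (by linarith) hp.le

/-- the index of the ancestor is determined by its generation -/
lemma dyad_index {j' k' j k : ℤ} (h : dyad j' k' ⊆ dyad j k) :
    k = ⌊(k' : ℝ) * dlen j' / dlen j⌋ := by
  rw [dyad_subset_iff] at h
  symm
  rw [Int.floor_eq_iff]
  have := dlen_pos j
  have := dlen_pos j'
  constructor
  · rw [le_div_iff₀ (by assumption)]
    exact h.1
  · rw [div_lt_iff₀ (by assumption)]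
    nlinarith [h.2]

lemma integrableOn_dyad {f : ℝ → ℝ} (hf : LocallyIntegrable f) (j k : ℤ) :
    IntegrableOn f (dyad j k) :=
  (hf.integrableOn_isCompact isCompact_Icc).mono_set Set.Ico_subset_Icc_self

lemma avg_pos {f : ℝ → ℝ} (hf : LocallyIntegrable f) (hp : ∀ x, 0 < f x) (j k : ℤ) :
    0 < avg f j k := by
  unfold avg
  have := dlen_pos j
  refine mul_pos (by positivity) ?_
  rw [setIntegral_pos_iff_support_of_nonneg_ae (Filter.Eventually.of_forall fun x => (hp x).le)
    (integrableOn_dyad hf j k)]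
  have : Function.support f = univ := by
    ext x; simp [(hp x).ne']
  rw [this, univ_inter, dyad, Real.volume_Ico, ENNReal.ofReal_pos]
  linarith

lemma avg_split {f : ℝ → ℝ} (hf : LocallyIntegrable f) (j k : ℤ) :
    avg f j k = (avg f (j + 1) (2 * k) + avg f (j + 1) (2 * k + 1)) / 2 := by
  have hp := dlen_pos j
  have hu : dyad j k = dyad (j + 1) (2 * k) ∪ dyad (j + 1) (2 * k + 1) := by
    unfold dyad
    rw [dlen_succ]
    push_cast
    rw [Set.Ico_union_Ico_eq_Ico (by linarith) (by linarith)]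
    congr 1 <;> ring
  have hd : Disjoint (dyad (j + 1) (2 * k)) (dyad (j + 1) (2 * k + 1)) := by
    unfold dyad
    rw [Set.Ico_disjoint_Ico]
    push_cast
    simp
  unfold avg
  rw [hu, setIntegral_union hd measurableSet_Ico (integrableOn_dyad hf _ _)
    (integrableOn_dyad hf _ _), dlen_succ]
  field_simp

lemma rpow_concave (β : ℝ) (h0 : 0 < β) (h1 : β < 1) :
    ConcaveOn ℝ (Icc 0 2) (fun x : ℝ => x ^ β + (β * (1 - β) / 8) * x ^ 2) := by
  have hd : ∀ x ∈ interior (Icc (0:ℝ) 2), HasDerivAt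
      (fun x : ℝ => x ^ β + (β * (1 - β) / 8) * x ^ 2)
      (β * x ^ (β - 1) + (β * (1 - β) / 8) * (2 * x)) x := by
    intro x hx
    rw [interior_Icc] at hx
    have e1 := Real.hasDerivAt_rpow_const (x := x) (p := β) (Or.inl hx.1.ne')
    have e2 := ((hasDerivAt_pow 2 x).const_mul (β * (1 - β) / 8))
    refine (e1.add e2).congr_deriv ?_
    norm_num
  refine concaveOn_of_hasDerivWithinAt2_nonpos (convex_Icc _ _) ?_
    (f' := fun x => β * x ^ (β - 1) + (β * (1 - β) / 8) * (2 * x))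
    (f'' := fun x => β * ((β - 1) * x ^ (β - 1 - 1)) + (β * (1 - β) / 8) * 2) ?_ ?_ ?_
  · exact ((Real.continuous_rpow_const h0.le).add (by fun_prop)).continuousOn
  · intro x hx
    exact (hd x hx).hasDerivWithinAt
  · intro x hx
    rw [interior_Icc] at hx
    have e1 := (Real.hasDerivAt_rpow_const (x := x) (p := β - 1) (Or.inl hx.1.ne')).const_mul β
    have e2 := (((hasDerivAt_id x).const_mul 2).const_mul (β * (1 - β) / 8))
    have := (e1.add e2).hasDerivWithinAt (s := interior (Icc (0:ℝ) 2))
    refine this.congr_deriv ?_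
    norm_num
  · intro x hx
    rw [interior_Icc] at hx
    have hk : (1:ℝ) / 4 ≤ x ^ (β - 1 - 1) := by
      have a1 : (2:ℝ) ^ (β - 1 - 1) ≤ x ^ (β - 1 - 1) :=
        Real.rpow_le_rpow_of_nonpos hx.1 hx.2.le (by linarith)
      have a2 : (2:ℝ) ^ (-2:ℝ) ≤ (2:ℝ) ^ (β - 1 - 1) :=
        Real.rpow_le_rpow_of_exponent_le (by norm_num) (by linarith)
      have a3 : (2:ℝ) ^ (-2:ℝ) = 1 / 4 := by
        rw [Real.rpow_neg (by norm_num)]; norm_num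
      rw [← a3]
      exact a2.trans a1
    have : 0 < β * (1 - β) := mul_pos h0 (by linarith)
    nlinarith

lemma rpow_mid (β : ℝ) (h0 : 0 < β) (h1 : β < 1) (s : ℝ) (hs : -1 ≤ s) (hs' : s ≤ 1) :
    (1 + s) ^ β + (1 - s) ^ β ≤ 2 - 2 * (β * (1 - β) / 8) * s ^ 2 := by
  have h := (rpow_concave β h0 h1).2 (⟨by linarith, by linarith⟩ : 1 + s ∈ Icc (0:ℝ) 2)
    (⟨by linarith, by linarith⟩ : 1 - s ∈ Icc (0:ℝ) 2)
    (by norm_num : (0:ℝ) ≤ 1 / 2) (by norm_num : (0:ℝ) ≤ 1 / 2) (by norm_num)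
  simp only [smul_eq_mul] at h
  have e : 1 / 2 * (1 + s) + 1 / 2 * (1 - s) = 1 := by ring
  rw [e, Real.one_rpow] at h
  nlinarith

lemma two_point (α : ℝ) (h0 : 0 < α) (h1 : α < 1 / 2) (s t : ℝ) (hs : -1 ≤ s) (hs' : s ≤ 1)
    (ht : -1 ≤ t) (ht' : t ≤ 1) :
    (((1 + s) * (1 + t)) ^ α + ((1 - s) * (1 - t)) ^ α) / 2 +
      (2 * α * (1 - 2 * α) / 16) * (s ^ 2 + t ^ 2) ≤ 1 := by
  have am : ∀ a b : ℝ, 0 ≤ a → 0 ≤ b → (a * b) ^ α ≤ (a ^ (2 * α) + b ^ (2 * α)) / 2 := by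
    intro a b ha hb
    have e : ∀ c : ℝ, 0 ≤ c → c ^ (2 * α) = (c ^ α) ^ 2 := by
      intro c hc
      rw [mul_comm, Real.rpow_mul hc]
      norm_num
    rw [Real.mul_rpow ha hb, e a ha, e b hb]
    nlinarith [sq_nonneg (a ^ α - b ^ α)]
  have a1 := am (1 + s) (1 + t) (by linarith) (by linarith)
  have a2 := am (1 - s) (1 - t) (by linarith) (by linarith)
  have b1 := rpow_mid (2 * α) (by linarith) (by linarith) s hs hs'
  have b2 := rpow_mid (2 * α) (by linarith) (by linarith) t ht ht'
  nlinarith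

lemma bellman (α : ℝ) (h0 : 0 < α) (h1 : α < 1 / 2) (u v u1 u2 v1 v2 : ℝ)
    (hu1 : 0 < u1) (hu2 : 0 < u2) (hv1 : 0 < v1) (hv2 : 0 < v2)
    (hu : u = (u1 + u2) / 2) (hv : v = (v1 + v2) / 2) :
    (2 * α * (1 - 2 * α) / 64) * ((u * v) ^ α *
      ((|u1 - u| + |u2 - u|) ^ 2 / u ^ 2 + (|v1 - v| + |v2 - v|) ^ 2 / v ^ 2)) +
      ((u1 * v1) ^ α + (u2 * v2) ^ α) / 2 ≤ (u * v) ^ α := by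
  have hup : 0 < u := by linarith
  have hvp : 0 < v := by linarith
  have key : ∀ x x1 x2 : ℝ, 0 < x → 0 < x1 → 0 < x2 → x = (x1 + x2) / 2 →
      ∃ s, -1 ≤ s ∧ s ≤ 1 ∧ x1 = x * (1 + s) ∧ x2 = x * (1 - s) ∧
        (|x1 - x| + |x2 - x|) ^ 2 / x ^ 2 = 4 * s ^ 2 := by
    intro x x1 x2 hx hx1 hx2 he
    have hs1 : x1 = x * (1 + (x1 - x) / x) := by field_simp; ring
    have hs2 : x2 = x * (1 - (x1 - x) / x) := by field_simp; linarith
    refine ⟨(x1 - x) / x, ?_, ?_, hs1, hs2, ?_⟩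
    · rw [le_div_iff₀ hx]; linarith
    · rw [div_le_iff₀ hx]; linarith
    · have : x2 - x = -(x1 - x) := by linarith
      rw [this, abs_neg, ← two_mul, mul_pow, sq_abs, div_pow]
      ring
  obtain ⟨s, hs, hs', e1, e2, e3⟩ := key u u1 u2 hup hu1 hu2 hu
  obtain ⟨t, ht, ht', f1, f2, f3⟩ := key v v1 v2 hvp hv1 hv2 hv
  rw [e3, f3]
  have g1 : (u1 * v1) ^ α = (u * v) ^ α * ((1 + s) * (1 + t)) ^ α := by
    rw [← Real.mul_rpow (by positivity) (mul_nonneg (by linarith) (by linarith)), e1, f1]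
    congr 1; ring
  have g2 : (u2 * v2) ^ α = (u * v) ^ α * ((1 - s) * (1 - t)) ^ α := by
    rw [← Real.mul_rpow (by positivity) (mul_nonneg (by linarith) (by linarith)), e2, f2]
    congr 1; ring
  rw [g1, g2]
  have hB : 0 ≤ (u * v) ^ α := by positivity
  have := mul_le_mul_of_nonneg_left (two_point α h0 h1 s t hs hs' ht ht') hB
  linarith

/-- truncated sums over dyadic descendants -/
lemma trunc_bound (f : ℤ × ℤ → ℝ≥0∞) (G : ℤ → ℤ → ℝ≥0∞)
    (hG : ∀ j k, f (j, k) + (G (j + 1) (2 * k) + G (j + 1) (2 * k + 1)) ≤ G j k) (N : ℕ) :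
    ∀ j k : ℤ, (∑' q : ℤ × ℤ, if dyad q.1 q.2 ⊆ dyad j k ∧ q.1 < j + N then f q else 0)
      ≤ G j k := by
  induction N with
  | zero =>
    intro j k
    have : ∀ q : ℤ × ℤ, (if dyad q.1 q.2 ⊆ dyad j k ∧ q.1 < j + (0 : ℕ) then f q else 0) = 0 := by
      intro q
      rw [if_neg]
      rintro ⟨h1, h2⟩
      have := dyad_subset_le h1
      simp at h2
      omega
    simp only [this]
    simp
  | succ N ih =>
    intro j k
    refine le_trans ?_ (hG j k)
    refine le_trans ?_ (add_le_add le_rfl (add_le_add (ih (j + 1) (2 * k))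
      (ih (j + 1) (2 * k + 1))))
    rw [← tsum_ite_eq (j, k) (fun _ => f (j, k)), ← ENNReal.tsum_add, ← ENNReal.tsum_add]
    refine ENNReal.tsum_le_tsum fun q => ?_
    by_cases h : dyad q.1 q.2 ⊆ dyad j k ∧ q.1 < j + (N + 1 : ℕ)
    · rw [if_pos h]
      obtain ⟨h1, h2⟩ := h
      have h3 : q.1 < j + 1 + N := by push_cast at h2; omega
      rcases dyad_subset_cases h1 with hc | hc | hc
      · have : q = (j, k) := Prod.ext hc.1 hc.2
        rw [if_pos this, this]
        exact le_self_add
      · rw [if_pos (⟨hc, h3⟩ : dyad q.1 q.2 ⊆ dyad (j + 1) (2 * k) ∧ q.1 < j + 1 + N)]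
        exact le_add_left le_self_add
      · rw [if_pos (⟨hc, h3⟩ : dyad q.1 q.2 ⊆ dyad (j + 1) (2 * k + 1) ∧ q.1 < j + 1 + N)]
        exact le_add_left (le_add_left le_rfl)
    · rw [if_neg h]
      exact zero_le

lemma full_bound (f : ℤ × ℤ → ℝ≥0∞) (G : ℤ → ℤ → ℝ≥0∞)
    (hG : ∀ j k, f (j, k) + (G (j + 1) (2 * k) + G (j + 1) (2 * k + 1)) ≤ G j k) (j k : ℤ) :
    (∑' q : ℤ × ℤ, if dyad q.1 q.2 ⊆ dyad j k then f q else 0) ≤ G j k := by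
  rw [ENNReal.tsum_eq_iSup_sum]
  refine iSup_le fun s => ?_
  obtain ⟨N, hN⟩ : ∃ N : ℕ, ∀ q ∈ s, q.1 < j + N := by
    obtain ⟨M, hM⟩ := (s.image fun q => (q.1 - j).toNat).bddAbove
    refine ⟨M + 1, fun q hq => ?_⟩
    have : (q.1 - j).toNat ≤ M := hM (by
      simp only [Finset.coe_image]
      exact ⟨q, hq, rfl⟩)
    omega
  refine le_trans ?_ (trunc_bound f G hG N j k)
  refine le_trans (Finset.sum_le_sum fun q hq => ?_) (ENNReal.sum_le_tsum s)
  by_cases h : dyad q.1 q.2 ⊆ dyad j k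
  · simp [h, hN q hq]
  · simp [h]

lemma count_bound (m : ℕ) (q : ℤ × ℤ) (P : ℤ × ℤ → Prop) [DecidablePred P] (a : ℝ≥0∞)
    (hP : ∀ L, P L → dyad q.1 q.2 ⊆ dyad L.1 L.2 ∧ q.1 ≤ L.1 + m) :
    (∑' L : ℤ × ℤ, if P L then a else 0) ≤ ((m : ℝ≥0∞) + 1) * a := by
  set S : Finset (ℤ × ℤ) := (Finset.Icc (q.1 - m) q.1).image
    (fun i => (i, ⌊(q.2 : ℝ) * dlen q.1 / dlen i⌋)) with hS
  have hmem : ∀ L, P L → L ∈ S := by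
    intro L hL
    obtain ⟨h1, h2⟩ := hP L hL
    rw [hS, Finset.mem_image]
    refine ⟨L.1, ?_, ?_⟩
    · rw [Finset.mem_Icc]
      have := dyad_subset_le h1
      omega
    · exact Prod.ext rfl (dyad_index h1).symm
  rw [tsum_eq_sum (s := S) (fun L hL => if_neg fun h => hL (hmem L h))]
  have hc : S.card ≤ m + 1 := by
    refine Finset.card_image_le.trans ?_
    rw [Int.card_Icc]
    omega
  calc (∑ L ∈ S, if P L then a else 0) ≤ ∑ L ∈ S, a := by
        refine Finset.sum_le_sum fun L _ => ?_
        split_ifs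
        · exact le_rfl
        · exact zero_le
    _ = (S.card : ℝ≥0∞) * a := by rw [Finset.sum_const, nsmul_eq_mul]
    _ ≤ ((m : ℝ≥0∞) + 1) * a := by
        gcongr
        exact_mod_cast hc

/-- the family `{μ̃_L}` is Carleson with constant `c_α (m+1) Q^α`. -/
theorem muTilde_carleson (α : ℝ) (hα0 : 0 < α) (hα : α < 1 / 2) :
    ∃ c : ℝ, 0 < c ∧
      ∀ (m n : ℕ) (w : ℝ → ℝ), (∀ x, 0 < w x) → Measurable w →
        LocallyIntegrable w → LocallyIntegrable (fun x => (w x)⁻¹) →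
      ∀ Q : ℝ, 1 ≤ Q →
        (∀ j k : ℤ, avg w j k * avg (fun x => (w x)⁻¹) j k ≤ Q) →
      ∀ j k : ℤ,
        (∑' L : ℤ × ℤ,
            if dyad L.1 L.2 ⊆ dyad j k then muTilde α w m n L.1 L.2 else 0)
          ≤ ENNReal.ofReal (c * ((m : ℝ) + 1) * Q ^ α * dlen j) := by
  have hd : 0 < 2 * α * (1 - 2 * α) / 64 := by
    have : 0 < 1 - 2 * α := by linarith
    positivity
  set d := 2 * α * (1 - 2 * α) / 64 with hdd
  refine ⟨d⁻¹, by positivity, ?_⟩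
  intro m n w hw _ hwi hsi Q hQ hA j k
  have hs : ∀ x, 0 < (w x)⁻¹ := fun x => inv_pos.2 (hw x)
  have up := avg_pos hwi hw
  have vp := avg_pos hsi hs
  set f : ℤ × ℤ → ℝ≥0∞ := fun q => ENNReal.ofReal (muTerm α w q.1 q.2) with hf
  set B : ℤ → ℤ → ℝ := fun j k =>
    d⁻¹ * (dlen j * (avg w j k * avg (fun x => (w x)⁻¹) j k) ^ α) with hB
  have hBn : ∀ j k, 0 ≤ B j k := by
    intro j k
    have := dlen_pos j
    have := up j k
    have := vp j k
    simp only [hB]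
    positivity
  have hG : ∀ j k, f (j, k) + (ENNReal.ofReal (B (j + 1) (2 * k)) +
      ENNReal.ofReal (B (j + 1) (2 * k + 1))) ≤ ENNReal.ofReal (B j k) := by
    intro j k
    have hl := dlen_pos j
    have hu := up j k
    have hv := vp j k
    have hmu : 0 ≤ muTerm α w j k := by
      unfold muTerm
      positivity
    simp only [hf]
    rw [← ENNReal.ofReal_add (hBn _ _) (hBn _ _), ← ENNReal.ofReal_add hmu
      (add_nonneg (hBn _ _) (hBn _ _))]
    apply ENNReal.ofReal_le_ofReal
    have hb := bellman α hα0 hα _ _ _ _ _ _ (up (j + 1) (2 * k)) (up (j + 1) (2 * k + 1))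
      (vp (j + 1) (2 * k)) (vp (j + 1) (2 * k + 1)) (avg_split hwi j k) (avg_split hsi j k)
    rw [← hdd] at hb
    have hb2 := mul_le_mul_of_nonneg_left hb (mul_pos (inv_pos.2 hd) hl).le
    simp only [hB, dlen_succ, muTerm, dOsc]
    refine le_trans (le_of_eq ?_) (hb2.trans (le_of_eq ?_))
    · field_simp
    · ring
  have main := full_bound f (fun j k => ENNReal.ofReal (B j k)) hG j k
  calc (∑' L : ℤ × ℤ, if dyad L.1 L.2 ⊆ dyad j k then muTilde α w m n L.1 L.2 else 0)
      = ∑' L : ℤ × ℤ, ∑' q : ℤ × ℤ,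
          if dyad L.1 L.2 ⊆ dyad j k ∧ IsStopping w m n L.1 L.2 q.1 q.2 then f q else 0 := by
        refine tsum_congr fun L => ?_
        by_cases h : dyad L.1 L.2 ⊆ dyad j k
        · simp [h, muTilde, hf]
        · simp [h]
    _ = ∑' q : ℤ × ℤ, ∑' L : ℤ × ℤ,
          if dyad L.1 L.2 ⊆ dyad j k ∧ IsStopping w m n L.1 L.2 q.1 q.2 then f q else 0 :=
        ENNReal.tsum_comm
    _ ≤ ∑' q : ℤ × ℤ, ((m : ℝ≥0∞) + 1) * (if dyad q.1 q.2 ⊆ dyad j k then f q else 0) := by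
        refine ENNReal.tsum_le_tsum fun q => ?_
        by_cases h : dyad q.1 q.2 ⊆ dyad j k
        · rw [if_pos h]
          exact count_bound m q (fun L => dyad L.1 L.2 ⊆ dyad j k ∧
            IsStopping w m n L.1 L.2 q.1 q.2) _ fun L hL => ⟨hL.2.1, hL.2.2.1⟩
        · have : ∀ L : ℤ × ℤ, (if dyad L.1 L.2 ⊆ dyad j k ∧
              IsStopping w m n L.1 L.2 q.1 q.2 then f q else 0) = 0 :=
            fun L => if_neg fun hL => h (hL.2.1.trans hL.1)
          simp only [this]
          simp
    _ = ((m : ℝ≥0∞) + 1) * ∑' q : ℤ × ℤ, (if dyad q.1 q.2 ⊆ dyad j k then f q else 0) :=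
        ENNReal.tsum_mul_left
    _ ≤ ((m : ℝ≥0∞) + 1) * ENNReal.ofReal (B j k) := by gcongr
    _ = ENNReal.ofReal (((m : ℝ) + 1) * B j k) := by
        rw [ENNReal.ofReal_mul (by positivity : (0:ℝ) ≤ (m : ℝ) + 1),
          ENNReal.ofReal_add (by positivity) (by norm_num)]
        simp
    _ ≤ _ := by
        apply ENNReal.ofReal_le_ofReal
        have hl := dlen_pos j
        have hq : (avg w j k * avg (fun x => (w x)⁻¹) j k) ^ α ≤ Q ^ α :=
          Real.rpow_le_rpow (mul_pos (up j k) (vp j k)).le (hA j k) hα0.le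
        have h2 := mul_le_mul_of_nonneg_left hq
          (by positivity : 0 ≤ ((m : ℝ) + 1) * (d⁻¹ * dlen j))
        simp only [hB]
        linarith
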